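/- arXiv:2112.04244 — 3 statements merged into one kernel-verified Lean document; each statement's English description precedes it below -/
import Mathlib

section
/- Let α be a finite set, let c ≥ 1 and k ≥ 1 be natural numbers, and let Y₁, …, Y_k ⊆ α be pairwise disjoint subsets with |Y_i| ≤ c for every i. Then the number of functions f : α → {1, …, c²} that split every Y_i is at least (1/4^k) · (c²)^{|α|}; equivalently, if f is chosen uniformly at random, then Pr[all Y_i are split] ≥ 1/4^k. -/
/-- Union bound for the number of injections from an `m`-element set to an `n`-element set. -/
theorem pow_mul_two_mul_sub_le_descFactorial (n m : ℕ) (h : m ≤ n) :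
    (n : ℝ) ^ m * (2 * n - m * (m - 1)) ≤ 2 * n * (n.descFactorial m : ℝ) := by
  induction m with
  | zero => simp
  | succ m ih =>
    have hm : m ≤ n := by omega
    have hn : (0 : ℝ) ≤ n - m := sub_nonneg.mpr (by exact_mod_cast hm)
    have hpair : (0 : ℝ) ≤ m * (m * (m - 1)) := by
      rcases Nat.eq_zero_or_pos m with rfl | hpos
      · simp
      · have : (1 : ℝ) ≤ m := by exact_mod_cast hpos
        have := sub_nonneg.mpr this
        positivity
    rw [Nat.descFactorial_succ]
    push_cast [Nat.cast_sub hm]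
    have step := mul_le_mul_of_nonneg_left (ih hm) hn
    have := mul_nonneg (pow_nonneg (Nat.cast_nonneg (α := ℝ) n) m) hpair
    rw [pow_succ]
    linarith

theorem sq_pow_div_four_le_descFactorial {c m : ℕ} (hc : 1 ≤ c) (hm : m ≤ c) :
    1 / 4 * ((c ^ 2 : ℕ) : ℝ) ^ m ≤ ((c ^ 2).descFactorial m : ℝ) := by
  have h := pow_mul_two_mul_sub_le_descFactorial (c ^ 2) m (by nlinarith)
  have hc' : (1 : ℝ) ≤ c := by exact_mod_cast hc
  have hm' : (m : ℝ) ≤ c := by exact_mod_cast hm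
  have hm0 : (0 : ℝ) ≤ m := Nat.cast_nonneg m
  have hN : (0 : ℝ) < ((c ^ 2 : ℕ) : ℝ) := by positivity
  have hpair : (m : ℝ) * (m - 1) ≤ ((c ^ 2 : ℕ) : ℝ) := by push_cast; nlinarith
  have hpow := pow_nonneg hN.le m
  have hle : ((c ^ 2 : ℕ) : ℝ) ^ m * ((c ^ 2 : ℕ) : ℝ) ≤
      2 * ((c ^ 2 : ℕ) : ℝ) * ((c ^ 2).descFactorial m : ℝ) :=
    (mul_le_mul_of_nonneg_left (by linarith) hpow).trans h
  have : ((c ^ 2 : ℕ) : ℝ) ^ m ≤ 2 * ((c ^ 2).descFactorial m : ℝ) :=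
    le_of_mul_le_mul_right (by linarith) hN
  linarith

open Classical in
/-- Glue injections on the members of a family of sets with a function on the remaining points. -/
noncomputable def glueEmbeddings {α β ι : Type*} (Y : ι → Finset α)
    (p : (∀ i, Y i ↪ β) × ({a // ∀ i, a ∉ Y i} → β)) (a : α) : β :=
  if h : ∃ i, a ∈ Y i then p.1 h.choose ⟨a, h.choose_spec⟩
  else p.2 ⟨a, not_exists.mp h⟩

section glueEmbeddings

variable {α β ι : Type*} {Y : ι → Finset α} (p : (∀ i, Y i ↪ β) × ({a // ∀ i, a ∉ Y i} → β))

theorem glueEmbeddings_of_mem (hdisj : ∀ i j, i ≠ j → Disjoint (Y i) (Y j)) {i : ι} {a : α}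
    (ha : a ∈ Y i) : glueEmbeddings Y p a = p.1 i ⟨a, ha⟩ := by
  have h : ∃ i, a ∈ Y i := ⟨i, ha⟩
  have key : ∀ j (hj : a ∈ Y j), p.1 j ⟨a, hj⟩ = p.1 i ⟨a, ha⟩ := by
    intro j hj
    obtain rfl : j = i := by
      by_contra hne
      exact Finset.disjoint_left.mp (hdisj j i hne) hj ha
    rfl
  rw [glueEmbeddings, dif_pos h]
  exact key _ h.choose_spec

theorem glueEmbeddings_of_forall_notMem {a : α} (ha : ∀ i, a ∉ Y i) :
    glueEmbeddings Y p a = p.2 ⟨a, ha⟩ :=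
  dif_neg (not_exists.mpr ha)

theorem glueEmbeddings_injOn (hdisj : ∀ i j, i ≠ j → Disjoint (Y i) (Y j)) (i : ι) :
    Set.InjOn (glueEmbeddings Y p) ↑(Y i) := by
  intro a ha b hb hab
  rw [glueEmbeddings_of_mem p hdisj (Finset.mem_coe.mp ha),
    glueEmbeddings_of_mem p hdisj (Finset.mem_coe.mp hb)] at hab
  exact congrArg Subtype.val ((p.1 i).injective hab)

theorem glueEmbeddings_injective (hdisj : ∀ i j, i ≠ j → Disjoint (Y i) (Y j)) :
    Function.Injective (glueEmbeddings (β := β) Y) := by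
  intro p q hpq
  refine Prod.ext ?_ ?_
  · ext i a
    have := congrFun hpq a
    rwa [glueEmbeddings_of_mem p hdisj a.2, glueEmbeddings_of_mem q hdisj a.2] at this
  · ext a
    have := congrFun hpq a
    rwa [glueEmbeddings_of_forall_notMem p a.2, glueEmbeddings_of_forall_notMem q a.2] at this

end glueEmbeddings

/-- The number of functions injective on each member of a disjoint family is at least the number
of ways to choose injections on the members and values elsewhere. -/
theorem prod_descFactorial_mul_pow_le_card_injOn {α β ι : Type*} [Finite α] [Finite β] [Fintype ι]
    (Y : ι → Finset α) (hdisj : ∀ i j, i ≠ j → Disjoint (Y i) (Y j)) :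
    (∏ i, (Nat.card β).descFactorial (Y i).card) * Nat.card β ^ Nat.card {a // ∀ i, a ∉ Y i} ≤
      Nat.card {f : α → β // ∀ i, Set.InjOn f ↑(Y i)} := by
  classical
  have := Fintype.ofFinite α
  have := Fintype.ofFinite β
  have h := Nat.card_le_card_of_injective
    (fun p ↦ (⟨glueEmbeddings Y p, glueEmbeddings_injOn p hdisj⟩ :
      {f : α → β // ∀ i, Set.InjOn f ↑(Y i)}))
    (fun p q hpq ↦ glueEmbeddings_injective hdisj (congrArg Subtype.val hpq))
  refine le_of_eq_of_le ?_ h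
  rw [Nat.card_prod, Nat.card_pi, Nat.card_fun]
  simp [Nat.card_eq_fintype_card, Fintype.card_embedding_eq]

theorem sum_card_add_card_forall_notMem {α ι : Type*} [Fintype α] [Fintype ι]
    (Y : ι → Finset α) (hdisj : ∀ i j, i ≠ j → Disjoint (Y i) (Y j)) :
    ∑ i, (Y i).card + Nat.card {a // ∀ i, a ∉ Y i} = Fintype.card α := by
  classical
  rw [← Finset.card_biUnion fun i _ j _ hij ↦ hdisj i j hij, ← Finset.card_add_card_compl,
    Nat.card_eq_fintype_card, Fintype.card_subtype]
  congr 2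
  ext a
  simp

/-- For pairwise disjoint subsets `Y₁, …, Y_k ⊆ α` each of size at most
`c`, the number of functions `f : α → {1, …, c²}` splitting (i.e. injective on) every
`Y_i` is at least `(1/4^k) · (c²)^{|α|}`; equivalently, a uniformly random `f` splits
all the `Y_i` with probability at least `1/4^k`. -/
theorem stmt10 (α : Type*) [Fintype α] (c k : ℕ) (hc : 1 ≤ c) (hk : 1 ≤ k)
    (Y : Fin k → Finset α) (hdisj : ∀ i j, i ≠ j → Disjoint (Y i) (Y j))
    (hcard : ∀ i, (Y i).card ≤ c) :
    (1 / (4 : ℝ) ^ k) * ((c ^ 2 : ℕ) : ℝ) ^ (Fintype.card α) ≤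
      (Nat.card {f : α → Fin (c ^ 2) // ∀ i, Set.InjOn f ↑(Y i)} : ℝ) := by
  have hcount := prod_descFactorial_mul_pow_le_card_injOn (β := Fin (c ^ 2)) Y hdisj
  rw [Nat.card_fin] at hcount
  refine le_trans ?_ (Nat.cast_le.mpr hcount)
  push_cast [← sum_card_add_card_forall_notMem Y hdisj]
  rw [pow_add, ← mul_assoc, ← Finset.prod_pow_eq_pow_sum]
  gcongr
  calc 1 / (4 : ℝ) ^ k * ∏ i, ((c : ℝ) ^ 2) ^ (Y i).card
      = ∏ i, (1 / 4 * ((c : ℝ) ^ 2) ^ (Y i).card) := by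
        simp [Finset.prod_mul_distrib]
    _ ≤ ∏ i, ((c ^ 2).descFactorial (Y i).card : ℝ) := by
        refine Finset.prod_le_prod (fun i _ ↦ by positivity) fun i _ ↦ ?_
        exact_mod_cast sq_pow_div_four_le_descFactorial hc (hcard i)
end

section
/- Let α be a finite set, let c ≥ 1 and k ≥ 1 be natural numbers, and let Y₁, …, Y_k ⊆ α be pairwise disjoint subsets with |Y_i| ≤ c for every i. Let δ be a real number with 0 < δ < 1, let β = 4^k/(4^k − 1), and let r be a natural number with r ≥ log_β(1/δ). Then the number of r-tuples (f₁, …, f_r) of functions f_j : α → {1, …, c²} such that no single f_j splits all of Y₁, …, Y_k simultaneously is at most δ · ((c²)^{|α|})^r; equivalently, if f₁, …, f_r are chosen independently and uniformly at random, then with probability at least 1 − δ there exists j such that f_j splits every Y_i. -/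
open Classical in
/-- In a set of functions closed under changing the value at `y`, at most a `1 / |β|` fraction
satisfies `f x = f y`. -/
theorem card_mul_card_filter_apply_eq_le {α β : Type*} [Fintype β]
    (G : Finset (α → β)) {x y : α} (hxy : x ≠ y)
    (hG : ∀ f ∈ G, ∀ v, Function.update f y v ∈ G) :
    (G.filter fun f => f x = f y).card * Fintype.card β ≤ G.card := by
  rw [← Finset.card_univ, ← Finset.card_product]
  refine Finset.card_le_card_of_injOn (fun p => Function.update p.1 y p.2) ?_ ?_
  · rintro ⟨f, v⟩ h
    simp only [Finset.coe_product, Set.mem_prod, Finset.mem_coe, Finset.mem_filter] at h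
    exact hG f h.1.1 v
  · rintro ⟨f, v⟩ h ⟨g, w⟩ h' heq
    simp only [Finset.coe_product, Set.mem_prod, Finset.mem_coe, Finset.mem_filter] at h h'
    have key : ∀ z, Function.update f y v z = Function.update g y w z := congrFun heq
    have hvw : v = w := by simpa using key y
    have hne : ∀ z, z ≠ y → f z = g z := fun z hz => by simpa [hz] using key z
    refine Prod.ext (funext fun z => ?_) hvw
    by_cases hz : z = y
    · subst hz
      exact h.1.2.symm.trans ((hne x hxy).trans h'.1.2)
    · exact hne z hz

open Classical in
/-- In a set of functions closed under changing values on `Y`, at least half of them are injective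
on `Y`, as soon as `|Y|² ≤ |β|`. -/
theorem card_le_two_mul_card_filter_injOn {α β : Type*} [Fintype β] [Nonempty β]
    (G : Finset (α → β)) (Y : Finset α) (hY : Y.card ^ 2 ≤ Fintype.card β)
    (hG : ∀ f ∈ G, ∀ y ∈ Y, ∀ v, Function.update f y v ∈ G) :
    G.card ≤ 2 * (G.filter fun f => Set.InjOn f (Y : Set α)).card := by
  set B := G.filter fun f => ¬ Set.InjOn f (Y : Set α) with hB
  have hsplit : (G.filter fun f => Set.InjOn f (Y : Set α)).card + B.card = G.card :=
    Finset.card_filter_add_card_filter_not _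
  have hpairs : ∀ f ∈ B, 2 ≤ (Y.offDiag.filter fun p => f p.1 = f p.2).card := by
    intro f hf
    have hf' := (Finset.mem_filter.mp hf).2
    simp only [Set.InjOn, not_forall] at hf'
    obtain ⟨x, hx, y, hy, hfxy, hxy⟩ := hf'
    have hsub : ({(x, y), (y, x)} : Finset (α × α)) ⊆
        Y.offDiag.filter fun p => f p.1 = f p.2 := by
      intro p hp
      simp only [Finset.mem_insert, Finset.mem_singleton] at hp
      rcases hp with rfl | rfl
      · simpa using ⟨⟨hx, hy, hxy⟩, hfxy⟩
      · simpa using ⟨⟨hy, hx, Ne.symm hxy⟩, hfxy.symm⟩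
    calc 2 = ({(x, y), (y, x)} : Finset (α × α)).card := by
          rw [Finset.card_pair]
          exact fun h => hxy (Prod.ext_iff.mp h).1
      _ ≤ _ := Finset.card_le_card hsub
  have hcount : B.card * 2 * Fintype.card β ≤ Fintype.card β * G.card := by
    calc B.card * 2 * Fintype.card β
        ≤ (∑ f ∈ B, (Y.offDiag.filter fun p => f p.1 = f p.2).card) * Fintype.card β := by
          gcongr
          simpa using Finset.card_nsmul_le_sum B _ 2 hpairs
      _ ≤ (∑ f ∈ G, (Y.offDiag.filter fun p => f p.1 = f p.2).card) * Fintype.card β := by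
          gcongr
          exact Finset.filter_subset _ _
      _ = ∑ p ∈ Y.offDiag, (G.filter fun f => f p.1 = f p.2).card * Fintype.card β := by
          rw [← Finset.sum_mul]
          congr 1
          exact Finset.sum_card_bipartiteAbove_eq_sum_card_bipartiteBelow
            (fun (f : α → β) (p : α × α) => f p.1 = f p.2)
      _ ≤ ∑ p ∈ Y.offDiag, G.card := by
          refine Finset.sum_le_sum fun p hp => ?_
          obtain ⟨-, h2, h3⟩ := Finset.mem_offDiag.mp hp
          exact card_mul_card_filter_apply_eq_le G h3 fun f hf => hG f hf _ h2
      _ ≤ Fintype.card β * G.card := by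
          rw [Finset.sum_const, smul_eq_mul, Finset.offDiag_card]
          gcongr
          exact (Nat.sub_le _ _).trans (by rwa [← sq])
  have hpos : 0 < Fintype.card β := Fintype.card_pos
  have : B.card * 2 ≤ G.card :=
    Nat.le_of_mul_le_mul_left (by rwa [mul_comm] at hcount) hpos
  omega

open Classical in
/-- At least a `2⁻ˢ` fraction of all functions splits `s` given disjoint sets, each of cardinality
at most the square root of the number of classes. -/
theorem card_pow_le_two_pow_mul_card_filter_injOn {α β ι : Type*} [Fintype α] [Fintype β]
    [Nonempty β] (Y : ι → Finset α) (hdisj : ∀ i j, i ≠ j → Disjoint (Y i) (Y j))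
    (hY : ∀ i, (Y i).card ^ 2 ≤ Fintype.card β) (S : Finset ι) :
    Fintype.card β ^ Fintype.card α ≤ 2 ^ S.card *
      (Finset.univ.filter fun f : α → β => ∀ i ∈ S, Set.InjOn f (Y i : Set α)).card := by
  induction S using Finset.induction_on with
  | empty => simp
  | insert a S ha ih =>
    have step := card_le_two_mul_card_filter_injOn
      (Finset.univ.filter fun f : α → β => ∀ i ∈ S, Set.InjOn f (Y i : Set α)) (Y a) (hY a) (by
        intro f hf y hy v
        simp only [Finset.mem_filter, Finset.mem_univ, true_and] at hf ⊢
        intro i hi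
        have hya : y ∉ Y i := Finset.disjoint_left.mp
          (hdisj a i fun h => ha (h ▸ hi)) hy
        refine (hf i hi).congr fun z hz => ?_
        rw [Function.update_of_ne]
        rintro rfl
        exact hya hz)
    have heq : ((Finset.univ.filter fun f : α → β =>
        ∀ i ∈ S, Set.InjOn f (Y i : Set α)).filter fun f => Set.InjOn f (Y a : Set α)) =
        Finset.univ.filter fun f : α → β => ∀ i ∈ insert a S, Set.InjOn f (Y i : Set α) := by
      ext f
      simp [and_comm]
    rw [heq] at step
    rw [Finset.card_insert_of_notMem ha, pow_succ, mul_assoc]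
    exact ih.trans (Nat.mul_le_mul_left _ step)


/-- With `Y₁, …, Y_k ⊆ α` pairwise disjoint of size at most `c`,
`β = 4^k/(4^k − 1)`, `0 < δ < 1` and `r ≥ log_β(1/δ)`, the number of `r`-tuples
`(f₁, …, f_r)` of functions `f_j : α → {1, …, c²}` such that no single `f_j` splits
all the `Y_i` simultaneously is at most `δ · ((c²)^{|α|})^r`; equivalently, with
independent uniform choices, some `f_j` splits every `Y_i` with probability ≥ `1 − δ`. -/
theorem stmt12 (α : Type*) [Fintype α] (c k : ℕ) (hc : 1 ≤ c) (hk : 1 ≤ k)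
    (Y : Fin k → Finset α) (hdisj : ∀ i j, i ≠ j → Disjoint (Y i) (Y j))
    (hcard : ∀ i, (Y i).card ≤ c)
    (β δ : ℝ) (hβ : β = (4 : ℝ) ^ k / ((4 : ℝ) ^ k - 1))
    (hδ0 : 0 < δ) (hδ1 : δ < 1) (r : ℕ) (hr : Real.logb β (1 / δ) ≤ (r : ℝ)) :
    (Nat.card {F : Fin r → α → Fin (c ^ 2) //
        ∀ j, ¬ (∀ i, Set.InjOn (F j) ↑(Y i))} : ℝ) ≤
      δ * (((c ^ 2 : ℕ) : ℝ) ^ (Fintype.card α)) ^ r := by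
  classical
  have : NeZero (c ^ 2) := ⟨by positivity⟩
  set T : ℝ := ((c ^ 2 : ℕ) : ℝ) ^ Fintype.card α with hT
  set P : (α → Fin (c ^ 2)) → Prop := fun f => ∀ i, Set.InjOn f (Y i : Set α)
  have hgood : T ≤ 4 ^ k * ((Finset.univ.filter P).card : ℝ) := by
    have h := card_pow_le_two_pow_mul_card_filter_injOn (β := Fin (c ^ 2)) Y hdisj
      (fun i => by simpa using Nat.pow_le_pow_left (hcard i) 2) Finset.univ
    simp only [Fintype.card_fin, Finset.card_univ, Finset.mem_univ, true_imp_iff] at h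
    have h' : T ≤ 2 ^ k * ((Finset.univ.filter P).card : ℝ) := by
      rw [hT]
      exact_mod_cast h
    refine h'.trans ?_
    gcongr
    norm_num
  have hsum : ((Finset.univ.filter P).card : ℝ) +
      ((Finset.univ.filter fun f => ¬ P f).card : ℝ) = T := by
    have h := Finset.card_filter_add_card_filter_not (s := Finset.univ) P
    rw [Finset.card_univ, Fintype.card_fun, Fintype.card_fin] at h
    rw [hT]
    exact_mod_cast h
  have hcount : Nat.card {F : Fin r → α → Fin (c ^ 2) // ∀ j, ¬ P (F j)} =
      (Finset.univ.filter fun f => ¬ P f).card ^ r := by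
    rw [Nat.card_congr (Equiv.subtypePiEquivPi (p := fun _ f => ¬ P f)), Nat.card_fun]
    simp [Fintype.card_subtype]
  have h4 : (1 : ℝ) < 4 ^ k := one_lt_pow₀ (by norm_num) (by omega)
  have hβ1 : 1 < β := by
    rw [hβ, lt_div_iff₀ (by linarith)]
    linarith
  have hβ0 : 0 < β := by linarith
  have hbad : ((Finset.univ.filter fun f => ¬ P f).card : ℝ) ≤ T / β := by
    rw [hβ, div_div_eq_mul_div, le_div_iff₀ (by linarith)]
    nlinarith
  have hδ : 1 / β ^ r ≤ δ := by
    rw [Real.logb_le_iff_le_rpow hβ1 (by positivity), Real.rpow_natCast] at hr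
    rwa [one_div_le (by positivity) hδ0]
  have hT0 : 0 ≤ T := by positivity
  calc (Nat.card {F : Fin r → α → Fin (c ^ 2) // ∀ j, ¬ P (F j)} : ℝ)
      = ((Finset.univ.filter fun f => ¬ P f).card : ℝ) ^ r := by rw [hcount]; push_cast; rfl
    _ ≤ (T / β) ^ r := by gcongr
    _ = 1 / β ^ r * T ^ r := by rw [div_pow]; ring
    _ ≤ δ * T ^ r := by gcongr
end

section
/- Let Z be a nonempty finite set of positive integers with maximum element M = max(Z), let k ≥ 2, and let P₁, …, P_k be pairwise disjoint subsets of Z with P₁ ∪ ⋯ ∪ P_k = Z (a partition of Z into k parts). Suppose some part P_a satisfies k·Σ(P_a) > k·M + Σ(Z). Then: (i) there exists a part P_b with k·Σ(P_b) < Σ(Z); and (ii) for any such b and any element z ∈ P_a, one has Σ(P_b) < Σ(P_b) + z < Σ(P_a) and Σ(P_b) < Σ(P_a) − z < Σ(P_a), i.e., moving z from P_a to P_b strictly decreases the larger of the two sums and strictly increases the smaller one while keeping both strictly between the old values. -/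
/-- Let `Z` be a nonempty finite set of positive integers with maximum
`M`, and let `P₁, …, P_k` (`k ≥ 2`) be a partition of `Z`. If some part `P_a` satisfies
`k·Σ(P_a) > k·M + Σ(Z)`, then (i) some part `P_b` satisfies `k·Σ(P_b) < Σ(Z)`, and
(ii) for any such `b` and any `z ∈ P_a`, moving `z` from `P_a` to `P_b` keeps both new
sums strictly between the old ones:
`Σ(P_b) < Σ(P_b) + z < Σ(P_a)` and `Σ(P_b) < Σ(P_a) − z < Σ(P_a)`. -/
theorem stmt15 (Z : Finset ℕ) (hZ : Z.Nonempty) (hpos : ∀ z ∈ Z, 0 < z)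
    (k : ℕ) (hk : 2 ≤ k) (P : Fin k → Finset ℕ)
    (hdisj : ∀ i j, i ≠ j → Disjoint (P i) (P j))
    (hcover : Finset.univ.biUnion P = Z)
    (a : Fin k) (ha : k * Z.max' hZ + ∑ x ∈ Z, x < k * ∑ x ∈ P a, x) :
    (∃ b : Fin k, k * ∑ x ∈ P b, x < ∑ x ∈ Z, x) ∧
    (∀ b : Fin k, k * ∑ x ∈ P b, x < ∑ x ∈ Z, x → ∀ z ∈ P a,
      (∑ x ∈ P b, x < ∑ x ∈ P b, x + z ∧ ∑ x ∈ P b, x + z < ∑ x ∈ P a, x) ∧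
      (∑ x ∈ P b, x < ∑ x ∈ P a, x - z ∧ ∑ x ∈ P a, x - z < ∑ x ∈ P a, x)) := by
  have hsum : ∑ i, ∑ x ∈ P i, x = ∑ x ∈ Z, x := by
    rw [← hcover, Finset.sum_biUnion fun i _ j _ hij => hdisj i j hij]
  refine ⟨?_, fun b hb z hz => ?_⟩
  · by_contra! h
    have hlt : ∑ _i : Fin k, ∑ x ∈ Z, x < ∑ i, k * ∑ x ∈ P i, x :=
      Finset.sum_lt_sum (fun i _ => h i) ⟨a, Finset.mem_univ a, by omega⟩
    rw [← Finset.mul_sum, hsum] at hlt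
    simp at hlt
  · have hzZ : z ∈ Z := hcover ▸ Finset.mem_biUnion.2 ⟨a, Finset.mem_univ a, hz⟩
    have hz_pos := hpos z hzZ
    have hz_max : k * z ≤ k * Z.max' hZ := Nat.mul_le_mul_left k (Z.le_max' z hzZ)
    have hlt : ∑ x ∈ P b, x + z < ∑ x ∈ P a, x := by
      refine Nat.lt_of_mul_lt_mul_left (a := k) ?_
      rw [mul_add]
      omega
    omega
end
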